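/- arXiv:math/0503620 — 2 statements merged into one kernel-verified Lean document; each statement's English description precedes it below -/
import Mathlib

section
/- Let F be a field and let A and B be finite nonempty subsets of F. For i = 1, …, k let λ_i ∈ F \ {0} and μ_i ∈ F, and write ν_i = |{(a,b) ∈ A × B : a + λ_i·b = μ_i}|. Let P(x,y) ∈ F[x,y]. Suppose that (1) for each i = 1, …, k there exist a ∈ A and b ∈ B with P(a,b) ≠ 0 and a + λ_i·b = μ_i, and (2) for each pair (a,b) ∈ A × B with P(a,b) ≠ 0 there is a unique i ∈ {1, …, k} with a + λ_i·b = μ_i. Then k + min{ν_1, …, ν_k} ≥ |A| + |B| - deg P. -/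
/-- The divided difference over `s` of a monomial of degree below `#s - 1` vanishes. -/
theorem sum_pow_div_prod_sub_eq_zero {F : Type*} [Field F] [DecidableEq F] (s : Finset F) {n : ℕ}
    (hn : n < s.card - 1) : ∑ a ∈ s, a ^ n / ∏ j ∈ s.erase a, (a - j) = 0 := by
  have h := Lagrange.coeff_eq_sum (s := s) (v := id) (Set.injOn_id _)
    (P := (Polynomial.X : Polynomial F) ^ n)
    (by rw [Polynomial.degree_X_pow]; exact_mod_cast (by omega : n < s.card))
  rw [Polynomial.coeff_X_pow, if_neg (by omega)] at h
  simpa using h.symm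

/-- A bivariate polynomial that is nonzero at exactly one point of the grid `A × B` has total
degree at least `(#A - 1) + (#B - 1)`. -/
theorem card_add_card_le_totalDegree_add_two {F : Type*} [Field F] [DecidableEq F]
    {A B : Finset F} {a₀ b₀ : F} (ha₀ : a₀ ∈ A) (hb₀ : b₀ ∈ B) (f : MvPolynomial (Fin 2) F)
    (hf : MvPolynomial.eval ![a₀, b₀] f ≠ 0)
    (h : ∀ a ∈ A, ∀ b ∈ B, (a, b) ≠ (a₀, b₀) → MvPolynomial.eval ![a, b] f = 0) :
    A.card + B.card ≤ f.totalDegree + 2 := by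
  by_contra! hlt
  have hprod (s : Finset F) (x : F) : ∏ j ∈ s.erase x, (x - j) ≠ 0 :=
    Finset.prod_ne_zero_iff.mpr fun j hj => sub_ne_zero.mpr (Finset.ne_of_mem_erase hj).symm
  have hzero : ∑ a ∈ A, ∑ b ∈ B, MvPolynomial.eval ![a, b] f /
      ((∏ j ∈ A.erase a, (a - j)) * ∏ j ∈ B.erase b, (b - j)) = 0 := by
    calc
      _ = ∑ d ∈ f.support, f.coeff d * ((∑ a ∈ A, a ^ d 0 / ∏ j ∈ A.erase a, (a - j)) *
          ∑ b ∈ B, b ^ d 1 / ∏ j ∈ B.erase b, (b - j)) := by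
        simp_rw [Finset.sum_mul_sum, Finset.mul_sum]
        rw [Finset.sum_comm (s := f.support)]
        refine Finset.sum_congr rfl fun a _ => ?_
        rw [Finset.sum_comm (s := f.support)]
        refine Finset.sum_congr rfl fun b _ => ?_
        rw [MvPolynomial.eval_eq', Finset.sum_div]
        refine Finset.sum_congr rfl fun d _ => ?_
        simp only [Fin.prod_univ_two, Matrix.cons_val_zero, Matrix.cons_val_one]
        rw [div_mul_div_comm, mul_div_assoc]
      _ = 0 := by
        refine Finset.sum_eq_zero fun d hd => ?_
        have hdeg : d 0 + d 1 ≤ f.totalDegree := by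
          simpa [Finsupp.sum_fintype] using MvPolynomial.le_totalDegree hd
        have hd' : d 0 < A.card - 1 ∨ d 1 < B.card - 1 := by omega
        rcases hd' with hd' | hd' <;> simp [sum_pow_div_prod_sub_eq_zero _ hd']
  rw [Finset.sum_eq_single_of_mem a₀ ha₀, Finset.sum_eq_single_of_mem b₀ hb₀] at hzero
  · exact div_ne_zero hf (mul_ne_zero (hprod A a₀) (hprod B b₀)) hzero
  · intro b hb hne
    simp [h a₀ ha₀ b hb (by simp [hne])]
  · intro a ha hne
    exact Finset.sum_eq_zero fun b hb => by simp [h a ha b hb (by simp [hne])]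

/-- A product of polynomials of total degree at most one has total degree at most the number of
factors. -/
theorem MvPolynomial.totalDegree_prod_le_card {R σ ι : Type*} [CommSemiring R] (s : Finset ι)
    (f : ι → MvPolynomial σ R) (hf : ∀ i ∈ s, (f i).totalDegree ≤ 1) :
    (∏ i ∈ s, f i).totalDegree ≤ s.card :=
  (MvPolynomial.totalDegree_finsetProd s f).trans (by simpa using Finset.sum_le_sum hf)

/-- **Lemma 2.1** (Pan–Sun). Let `A`, `B` be finite nonempty subsets of a field `F`. For
`i = 1, …, k` let `λᵢ ∈ F \ {0}`, `μᵢ ∈ F`, and `νᵢ = |{(a,b) ∈ A × B : a + λᵢ b = μᵢ}|`.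
Let `P(x,y) ∈ F[x,y]`. Suppose that (1) for each `i` there are `a ∈ A`, `b ∈ B` with
`P(a,b) ≠ 0` and `a + λᵢ b = μᵢ`, and (2) for each `(a,b) ∈ A × B` with `P(a,b) ≠ 0` there
is a unique `i` with `a + λᵢ b = μᵢ`. Then `k + min{ν₁, …, ν_k} ≥ |A| + |B| - deg P`. -/
theorem stmt5 {F : Type*} [Field F] [DecidableEq F]
    (A B : Finset F) (hA : A.Nonempty) (hB : B.Nonempty)
    (k : ℕ) (hk : 0 < k) (lam mu : Fin k → F) (hlam : ∀ i, lam i ≠ 0)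
    (P : MvPolynomial (Fin 2) F)
    (h1 : ∀ i : Fin k, ∃ a ∈ A, ∃ b ∈ B,
      MvPolynomial.eval ![a, b] P ≠ 0 ∧ a + lam i * b = mu i)
    (h2 : ∀ a ∈ A, ∀ b ∈ B, MvPolynomial.eval ![a, b] P ≠ 0 →
      ∃! i : Fin k, a + lam i * b = mu i) :
    (k : ℤ) + (Finset.univ.inf' (Finset.univ_nonempty_iff.mpr ⟨⟨0, hk⟩⟩)
        fun i : Fin k => (((A ×ˢ B).filter fun p => p.1 + lam i * p.2 = mu i).card : ℤ))
      ≥ (A.card : ℤ) + B.card - P.totalDegree := by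
  rw [ge_iff_le, ← sub_le_iff_le_add', Finset.le_inf'_iff]
  intro i _
  obtain ⟨a₀, ha₀, b₀, hb₀, hP, hline⟩ := h1 i
  set S := (A ×ˢ B).filter fun p => p.1 + lam i * p.2 = mu i
  have hmem : (a₀, b₀) ∈ S := by simp [S, ha₀, hb₀, hline]
  -- the other lines, and the vertical lines through the other points of line `i`
  let L := ∏ j ∈ Finset.univ.erase i,
    (MvPolynomial.X 0 + MvPolynomial.C (lam j) * MvPolynomial.X 1 - MvPolynomial.C (mu j) :
      MvPolynomial (Fin 2) F)
  let V := ∏ p ∈ S.erase (a₀, b₀),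
    (MvPolynomial.X 0 - MvPolynomial.C p.1 : MvPolynomial (Fin 2) F)
  have hLdeg : L.totalDegree ≤ k - 1 := by
    refine (MvPolynomial.totalDegree_prod_le_card _ _ fun j _ => ?_).trans_eq (by simp)
    refine (MvPolynomial.totalDegree_sub_C_le _ _).trans
      ((MvPolynomial.totalDegree_add _ _).trans (max_le ?_ ?_))
    · simp
    · exact (MvPolynomial.totalDegree_mul _ _).trans (by simp)
  have hVdeg : V.totalDegree ≤ S.card - 1 := by
    refine (MvPolynomial.totalDegree_prod_le_card _ _ fun p _ => ?_).trans_eq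
      (Finset.card_erase_of_mem hmem)
    exact (MvPolynomial.totalDegree_sub_C_le _ _).trans (by simp)
  have hLeval (a b : F) : MvPolynomial.eval ![a, b] L =
      ∏ j ∈ Finset.univ.erase i, (a + lam j * b - mu j) := by
    simp [L, map_prod]
  have hVeval (a b : F) : MvPolynomial.eval ![a, b] V = ∏ p ∈ S.erase (a₀, b₀), (a - p.1) := by
    simp [V, map_prod]
  have hmain : A.card + B.card ≤ (P * L * V).totalDegree + 2 := by
    refine card_add_card_le_totalDegree_add_two ha₀ hb₀ _ ?_ ?_
    · rw [map_mul, map_mul, hLeval, hVeval]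
      refine mul_ne_zero (mul_ne_zero hP ?_) ?_ <;> rw [Finset.prod_ne_zero_iff]
      · intro j hj h0
        exact Finset.ne_of_mem_erase hj
          ((h2 a₀ ha₀ b₀ hb₀ hP).unique (sub_eq_zero.mp h0) hline)
      · rintro ⟨a, b⟩ hp h0
        obtain ⟨hne, hpS⟩ := Finset.mem_erase.mp hp
        have hab : a + lam i * b = mu i := (Finset.mem_filter.mp hpS).2
        have haa : a₀ = a := sub_eq_zero.mp h0
        subst haa
        exact hne (by rw [mul_left_cancel₀ (hlam i) (add_left_cancel (hab.trans hline.symm))])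
    · intro a ha b hb hne
      rw [map_mul, map_mul, hLeval, hVeval]
      by_cases hPab : MvPolynomial.eval ![a, b] P = 0
      · simp [hPab]
      obtain ⟨j, hj, -⟩ := h2 a ha b hb hPab
      by_cases hji : j = i
      · subst hji
        rw [Finset.prod_eq_zero (i := (a, b)) (s := S.erase (a₀, b₀)) (by simp [S, ha, hb, hj, hne])
          (sub_self a), mul_zero]
      · rw [Finset.prod_eq_zero (i := j) (s := Finset.univ.erase i) (by simp [hji])
          (sub_eq_zero.mpr hj), mul_zero, zero_mul]
  have h₁ := MvPolynomial.totalDegree_mul (P * L) V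
  have h₂ := MvPolynomial.totalDegree_mul P L
  have hSpos : 0 < S.card := Finset.card_pos.mpr ⟨_, hmem⟩
  omega
end

section
/- Let G be an abelian group whose torsion subgroup Tor(G) = {g ∈ G : g has finite order} is cyclic, and let A and B be finite nonempty subsets of G such that the restricted sumset A ∔ B = {a+b : a ∈ A, b ∈ B, a ≠ b} is nonempty. Then |A ∔ B| ≥ |A| + |B| - 2 - min_{c ∈ A ∔ B} ν_{A,B}(c). -/
open MvPolynomial in
/-- A bivariate polynomial over a domain that vanishes at all points of a nonempty grid `S ×ˢ T`
except exactly one has total degree at least `#S + #T - 2`. -/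
theorem card_add_card_le_totalDegree_add_two_s7 {R : Type*} [CommRing R] [IsDomain R]
    (S T : Finset R) (P : MvPolynomial (Fin 2) R) {x y : R} (hx : x ∈ S) (hy : y ∈ T)
    (hne : eval ![x, y] P ≠ 0)
    (hzero : ∀ a ∈ S, ∀ b ∈ T, (a, b) ≠ (x, y) → eval ![a, b] P = 0) :
    S.card + T.card ≤ P.totalDegree + 2 := by
  classical
  by_contra! hlt
  let m : MonomialOrder (Fin 2) := MonomialOrder.degLex
  let L : Fin 2 → Finset R → MvPolynomial (Fin 2) R := fun i U ↦ ∏ r ∈ U, (X i - C r)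
  have hLmonic (i U) : m.Monic (L i U) := MonomialOrder.Monic.prod fun r _ ↦ m.monic_X_sub_C i r
  have hLdeg (i U) : m.degree (L i U) = Finsupp.single i U.card := by
    rw [MonomialOrder.degree_prod_of_regular]
    · simp [Finset.sum_congr rfl (fun r _ ↦ m.degree_X_sub_C i r)]
    · intro r _
      rw [m.monic_X_sub_C]
      exact isRegular_one
  have hLtot (i U) : (L i U).totalDegree ≤ U.card := by
    refine (totalDegree_finsetProd _ _).trans ?_
    refine (Finset.sum_le_card_nsmul _ _ 1 fun r _ ↦ ?_).trans (by simp)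
    exact (totalDegree_sub_C_le _ _).trans (by simp)
  let K := L 0 (S.erase x) * L 1 (T.erase y)
  let t : Fin 2 →₀ ℕ := Finsupp.single 0 (S.erase x).card + Finsupp.single 1 (T.erase y).card
  have hS := Finset.card_erase_add_one hx
  have hT := Finset.card_erase_add_one hy
  have ht : t.degree = (S.erase x).card + (T.erase y).card := by simp [t]
  have hKcoeff : K.coeff t = 1 := by
    have hdeg : m.degree K = t := by
      rw [MonomialOrder.degree_mul (hLmonic _ _).ne_zero (hLmonic _ _).ne_zero, hLdeg, hLdeg]
    rw [← hdeg]
    exact (hLmonic _ _).mul (hLmonic _ _)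
  have hKtot : K.totalDegree ≤ t.degree := by
    rw [ht]
    exact (totalDegree_mul _ _).trans (add_le_add (hLtot _ _) (hLtot _ _))
  have hPcoeff : P.coeff t = 0 := coeff_eq_zero_of_totalDegree_lt (by
    change _ < t.degree
    lia)
  let Q := C (eval ![x, y] K) * P - C (eval ![x, y] P) * K
  have hQcoeff : Q.coeff t ≠ 0 := by
    simpa [Q, hPcoeff, hKcoeff] using hne
  have hQtot : Q.totalDegree = t.degree := by
    refine le_antisymm ?_ (le_totalDegree (mem_support_iff.2 hQcoeff))
    refine (totalDegree_sub _ _).trans (max_le ?_ ?_)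
    · refine (totalDegree_mul _ _).trans ?_
      rw [totalDegree_C]
      lia
    · refine (totalDegree_mul _ _).trans ?_
      rw [totalDegree_C]
      lia
  obtain ⟨s, hs, hsQ⟩ := combinatorial_nullstellensatz_exists_eval_nonzero Q t hQcoeff hQtot
    ![S, T] (by simp [Fin.forall_fin_two, t, hx, hy, show S.Nonempty from ⟨x, hx⟩,
      show T.Nonempty from ⟨y, hy⟩])
  have hs0 : s 0 ∈ S := hs 0
  have hs1 : s 1 ∈ T := hs 1
  have hseq : s = ![s 0, s 1] := by ext i; fin_cases i <;> rfl
  apply hsQ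
  by_cases h : (s 0, s 1) = (x, y)
  · obtain ⟨h0, h1⟩ := Prod.ext_iff.1 h
    simp only at h0 h1
    rw [hseq, h0, h1]
    simp [Q, mul_comm]
  · have hP : eval s P = 0 := by rw [hseq]; exact hzero _ hs0 _ hs1 h
    have hK : eval s K = 0 := by
      by_cases h0 : s 0 = x
      · have h1 : s 1 ≠ y := fun h1 ↦ h (by rw [h0, h1])
        simp only [K, L, map_mul, map_prod]
        rw [Finset.prod_eq_zero (i := s 1) (s := T.erase y) (by simp [h1, hs1]) (by simp), mul_zero]
      · simp only [K, L, map_mul, map_prod]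
        rw [Finset.prod_eq_zero (i := s 0) (s := S.erase x) (by simp [h0, hs0]) (by simp), zero_mul]
    simp [Q, hP, hK]

/-- A torsion-free abelian group has two unique sums. -/
theorem IsAddTorsionFree.twoUniqueSums (G : Type*) [AddCommGroup G] [IsAddTorsionFree G] :
    TwoUniqueSums G :=
  TwoUniqueSums.of_injective_addHom (DivisibleHull.coeAddMonoidHom G).toAddHom
    DivisibleHull.coe_injective inferInstance

/-- If the torsion subgroup of `G` is cyclic, some character of `G` is faithful on it. -/
theorem exists_addMonoidHom_unitAddCircle_injOn_torsion {G : Type*} [AddCommGroup G]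
    (hTor : IsAddCyclic (AddCommGroup.torsion G)) :
    ∃ χ : G →+ UnitAddCircle, ∀ g ∈ AddCommGroup.torsion G, χ g = 0 → g = 0 := by
  have : Finite (AddCommGroup.torsion G) := by
    obtain ⟨g, hg⟩ := hTor.exists_generator
    have hfin : IsOfFinAddOrder g := AddSubmonoid.isOfFinAddOrder_coe.1 g.2
    have : Finite (AddSubgroup.zmultiples g) := finite_zmultiples.2 hfin
    exact Finite.of_surjective (fun z : AddSubgroup.zmultiples g ↦ (z : AddCommGroup.torsion G))
      fun t ↦ ⟨⟨t, hg t⟩, rfl⟩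
  let e := (zmodAddCyclicAddEquiv hTor).symm
  obtain ⟨χ, hχ⟩ := (Module.Baer.of_divisible UnitAddCircle).extension_property_addMonoidHom
    (AddCommGroup.torsion G).subtype Subtype.val_injective (ZMod.toAddCircle.comp e.toAddMonoidHom)
  refine ⟨χ, fun g hg h ↦ ?_⟩
  have h' := DFunLike.congr_fun hχ ⟨g, hg⟩
  have h0 : ZMod.toAddCircle (e ⟨g, hg⟩) = 0 := h'.symm.trans h
  rw [ZMod.toAddCircle_eq_zero, EmbeddingLike.map_eq_zero_iff] at h0
  exact congrArg Subtype.val h0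

/-- An abelian group whose torsion subgroup is cyclic embeds into the multiplicative monoid of a
domain. -/
theorem exists_injective_monoidHom_domain.{u} {G : Type u} [AddCommGroup G]
    (hTor : IsAddCyclic (AddCommGroup.torsion G)) :
    ∃ (R : Type u) (_ : CommRing R) (_ : IsDomain R) (φ : Multiplicative G →* R),
      Function.Injective φ := by
  obtain ⟨χ, hχ⟩ := exists_addMonoidHom_unitAddCircle_injOn_torsion hTor
  have := IsAddTorsionFree.twoUniqueSums (G ⧸ AddCommGroup.torsion G)
  refine ⟨AddMonoidAlgebra ℂ (G ⧸ AddCommGroup.torsion G), inferInstance, inferInstance,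
    { toFun := fun g ↦ AddMonoidAlgebra.single (QuotientAddGroup.mk g.toAdd)
        ((AddCircle.toCircle (χ g.toAdd) : Circle) : ℂ)
      map_one' := ?_
      map_mul' := ?_ }, ?_⟩
  · simp; rfl
  · intro g h
    simp [AddMonoidAlgebra.single_mul_single, AddCircle.toCircle_add]
  · intro g h hgh
    obtain ⟨h1, h2⟩ | ⟨h1, -⟩ := AddMonoidAlgebra.single_inj.1 hgh
    · have h3 := AddCircle.injective_toCircle one_ne_zero (Circle.coe_injective h2)
      have h4 := hχ (-g.toAdd + h.toAdd) (QuotientAddGroup.eq.1 h1) (by simp [h3])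
      exact Multiplicative.toAdd.injective (neg_add_eq_zero.1 h4)
    · exact absurd h1 (Circle.coe_ne_zero _)

open MvPolynomial in
/-- If `c` is a restricted sum of `A` and `B` and `G` embeds into a domain, then
`|A| + |B| ≤ |A ∔ B| + ν_{A,B}(c) + 2`. -/
theorem card_add_card_le_of_mem_restricted_sumset {G R : Type*} [AddCommGroup G] [DecidableEq G]
    [CommRing R] [IsDomain R] {φ : Multiplicative G →* R} (hφ : Function.Injective φ)
    {A B C : Finset G} (hC : ∀ a ∈ A, ∀ b ∈ B, a ≠ b → a + b ∈ C) {a₀ b₀ : G}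
    (ha₀ : a₀ ∈ A) (hb₀ : b₀ ∈ B) (hab : a₀ ≠ b₀) :
    A.card + B.card ≤
      C.card + ((A ×ˢ B).filter fun p => p.1 + p.2 = a₀ + b₀).card + 2 := by
  classical
  let f : G → R := fun g ↦ φ (Multiplicative.ofAdd g)
  have hf : Function.Injective f := hφ.comp Multiplicative.ofAdd.injective
  have hadd (g h) : f g * f h = f (g + h) := (map_mul φ _ _).symm
  have hf0 : f 0 = 1 := map_one φ
  let N := (A ×ˢ B).filter fun p ↦ p.1 + p.2 = a₀ + b₀
  have hN : (a₀, b₀) ∈ N := by simp [N, ha₀, hb₀]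
  let E := N.erase (a₀, b₀)
  let D := C.erase (a₀ + b₀)
  let P : MvPolynomial (Fin 2) R :=
    (X 0 * X 1 - 1) * (∏ c ∈ D, (X 0 - MvPolynomial.C (f c) * X 1)) *
      ∏ p ∈ E, (X 0 - MvPolynomial.C (f p.1))
  have hPeval (a b : G) : eval ![f a, f (-b)] P =
      (f (a - b) - f 0) * (∏ c ∈ D, (f a - f (c - b))) * ∏ p ∈ E, (f a - f p.1) := by
    simp [P, map_prod, hadd, hf0, sub_eq_add_neg]
  have hPdeg : P.totalDegree ≤ 2 + D.card + E.card := by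
    refine (totalDegree_mul _ _).trans (add_le_add ((totalDegree_mul _ _).trans
      (add_le_add ?_ ?_)) ?_)
    · refine (totalDegree_sub _ _).trans (max_le ((totalDegree_mul _ _).trans ?_) ?_) <;> simp
    · refine (totalDegree_finsetProd _ _).trans
        ((Finset.sum_le_card_nsmul _ _ 1 fun r _ ↦ ?_).trans (by simp))
      refine (totalDegree_sub _ _).trans (max_le (by simp) ((totalDegree_mul _ _).trans (by simp)))
    · refine (totalDegree_finsetProd _ _).trans
        ((Finset.sum_le_card_nsmul _ _ 1 fun r _ ↦ ?_).trans (by simp))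
      exact (totalDegree_sub_C_le _ _).trans (by simp)
  have hmain := card_add_card_le_totalDegree_add_two_s7 (A.image f) (B.image fun b ↦ f (-b)) P
    (Finset.mem_image_of_mem f ha₀) (Finset.mem_image_of_mem (fun b ↦ f (-b)) hb₀) ?_ ?_
  · rw [Finset.card_image_of_injective _ hf,
      Finset.card_image_of_injective _ (f := fun b ↦ f (-b)) (hf.comp neg_injective)] at hmain
    have hE : E.card + 1 = N.card := Finset.card_erase_add_one hN
    have hD : D.card + 1 = C.card := Finset.card_erase_add_one (hC _ ha₀ _ hb₀ hab)
    change _ ≤ C.card + N.card + 2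
    lia
  · rw [hPeval]
    refine mul_ne_zero (mul_ne_zero ?_ (Finset.prod_ne_zero_iff.2 fun c hc ↦ ?_))
      (Finset.prod_ne_zero_iff.2 fun p hp ↦ ?_)
    · exact sub_ne_zero.2 (hf.ne (sub_ne_zero.2 hab))
    · refine sub_ne_zero.2 (hf.ne fun h ↦ Finset.ne_of_mem_erase hc ?_)
      rw [h, sub_add_cancel]
    · refine sub_ne_zero.2 (hf.ne fun h ↦ Finset.ne_of_mem_erase hp ?_)
      have hsum := (Finset.mem_filter.1 (Finset.mem_of_mem_erase hp)).2
      rw [← h] at hsum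
      exact Prod.ext h.symm (add_left_cancel hsum)
  · simp only [Finset.forall_mem_image]
    intro a ha b hb hne
    rw [hPeval]
    obtain rfl | hab' := eq_or_ne a b
    · simp
    by_cases hc : a + b = a₀ + b₀
    · have hmem : (a, b) ∈ E := by
        refine Finset.mem_erase.2 ⟨fun h ↦ hne ?_, by simp [N, ha, hb, hc]⟩
        rw [(Prod.mk.inj h).1, (Prod.mk.inj h).2]
      rw [Finset.prod_eq_zero (s := E) hmem (sub_self _), mul_zero]
    · have hmem : a + b ∈ D := Finset.mem_erase.2 ⟨hc, hC a ha b hb hab'⟩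
      rw [Finset.prod_eq_zero (s := D) hmem (by simp), mul_zero, zero_mul]


/-- Advance on Lev's conjecture (Pan–Sun). Let `G` be an abelian group whose torsion
subgroup is cyclic, and let `A`, `B` be finite nonempty subsets of `G` with
`A ∔ B = {a + b : a ∈ A, b ∈ B, a ≠ b}` nonempty. Then
`|A ∔ B| ≥ |A| + |B| - 2 - min_{c ∈ A ∔ B} ν_{A,B}(c)`. -/
theorem stmt7 {G : Type*} [AddCommGroup G] [DecidableEq G]
    (hTor : IsAddCyclic (AddCommGroup.torsion G))
    (A B : Finset G) (hA : A.Nonempty) (hB : B.Nonempty)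
    (C : Finset G)
    (hC : C = ((A ×ˢ B).filter fun p => p.1 ≠ p.2).image fun p => p.1 + p.2)
    (hCne : C.Nonempty) :
    (C.card : ℤ) ≥ (A.card : ℤ) + B.card - 2 -
      C.inf' hCne (fun c => (((A ×ˢ B).filter fun p => p.1 + p.2 = c).card : ℤ)) := by
  obtain ⟨R, _, _, φ, hφ⟩ := exists_injective_monoidHom_domain hTor
  obtain ⟨c, hc, hmin⟩ := C.exists_mem_eq_inf' hCne
    (fun c => (((A ×ˢ B).filter fun p => p.1 + p.2 = c).card : ℤ))
  rw [hmin]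
  have hsum : ∀ a ∈ A, ∀ b ∈ B, a ≠ b → a + b ∈ C := fun a ha b hb hab ↦
    hC ▸ Finset.mem_image.2 ⟨(a, b), by simp [ha, hb, hab], rfl⟩
  rw [hC] at hc
  obtain ⟨⟨a, b⟩, hp, rfl⟩ := Finset.mem_image.1 hc
  simp only [Finset.mem_filter, Finset.mem_product] at hp
  have := card_add_card_le_of_mem_restricted_sumset hφ hsum hp.1.1 hp.1.2 hp.2
  dsimp only
  lia
end
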